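/- arXiv:2507.03880 — 2 statements merged into one kernel-verified Lean document; each statement's English description precedes it below -/
import Mathlib

section
/- Let u^{(1)},…,u^{(n)} : ℝ² → ℝ be smooth solutions of the MCSP equation with 1 + S(x,t) > 0 for all (x,t). Let φ : ℝ² → ℝ be a smooth function of (X,T) satisfying ∂_X φ(X,T) = (1 + S(φ(X,T),T))^{-1/2} and ∂_T φ(X,T) = −F(φ(X,T),T)/2 for all (X,T). Define U^{(i)}(X,T) := u^{(i)}(φ(X,T),T) and R(X,T) := (1 + S(φ(X,T),T))^{-1/2}. Then ∂_X∂_T U^{(i)} = U^{(i)}·R for i = 1,…,n, and ∂_T R + (1/2) ∂_X( Σ_{1≤j<k≤n} c_{jk} U^{(j)} U^{(k)} ) = 0. -/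
/-- Partial derivative with respect to the first variable. -/
noncomputable def pdx (f : ℝ → ℝ → ℝ) (x t : ℝ) : ℝ := deriv (fun y => f y t) x

/-- Partial derivative with respect to the second variable. -/
noncomputable def pdt (f : ℝ → ℝ → ℝ) (x t : ℝ) : ℝ := deriv (fun s => f x s) t

/-- S = Σ_{1≤j<k≤n} c_{jk} ∂_x u^{(j)} ∂_x u^{(k)}. -/
noncomputable def Sfun {n : ℕ} (c : Fin n → Fin n → ℝ) (u : Fin n → ℝ → ℝ → ℝ)
    (x t : ℝ) : ℝ :=
  ∑ j : Fin n, ∑ k : Fin n,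
    if j < k then c j k * pdx (u j) x t * pdx (u k) x t else 0

/-- F = Σ_{1≤j<k≤n} c_{jk} u^{(j)} u^{(k)}. -/
noncomputable def Ffun {n : ℕ} (c : Fin n → Fin n → ℝ) (u : Fin n → ℝ → ℝ → ℝ)
    (x t : ℝ) : ℝ :=
  ∑ j : Fin n, ∑ k : Fin n,
    if j < k then c j k * u j x t * u k x t else 0

section PartialDerivatives

variable {f : ℝ → ℝ → ℝ}

lemma pdx_eq_fderiv (hf : Differentiable ℝ (fun p : ℝ × ℝ => f p.1 p.2)) (x t : ℝ) :
    pdx f x t = fderiv ℝ (fun p : ℝ × ℝ => f p.1 p.2) (x, t) (1, 0) :=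
  ((hf (x, t)).hasFDerivAt.comp_hasDerivAt (f := fun y => (y, t)) x
    ((hasDerivAt_id x).prodMk (hasDerivAt_const x t))).deriv

lemma pdt_eq_fderiv (hf : Differentiable ℝ (fun p : ℝ × ℝ => f p.1 p.2)) (x t : ℝ) :
    pdt f x t = fderiv ℝ (fun p : ℝ × ℝ => f p.1 p.2) (x, t) (0, 1) :=
  ((hf (x, t)).hasFDerivAt.comp_hasDerivAt (f := fun s => (x, s)) t
    ((hasDerivAt_const t x).prodMk (hasDerivAt_id t))).deriv

lemma contDiff_pdx (hf : ContDiff ℝ (⊤ : ℕ∞) (fun p : ℝ × ℝ => f p.1 p.2)) :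
    ContDiff ℝ (⊤ : ℕ∞) (fun p : ℝ × ℝ => pdx f p.1 p.2) := by
  simp_rw [pdx_eq_fderiv (hf.differentiable (by simp))]
  exact (hf.fderiv_right (by simp)).clm_apply contDiff_const

lemma contDiff_pdt (hf : ContDiff ℝ (⊤ : ℕ∞) (fun p : ℝ × ℝ => f p.1 p.2)) :
    ContDiff ℝ (⊤ : ℕ∞) (fun p : ℝ × ℝ => pdt f p.1 p.2) := by
  simp_rw [pdt_eq_fderiv (hf.differentiable (by simp))]
  exact (hf.fderiv_right (by simp)).clm_apply contDiff_const

lemma hasDerivAt_pdx (hf : Differentiable ℝ (fun p : ℝ × ℝ => f p.1 p.2)) (x t : ℝ) :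
    HasDerivAt (fun y => f y t) (pdx f x t) x := by
  have h : Differentiable ℝ (fun y => f y t) :=
    hf.comp (differentiable_id.prodMk (differentiable_const t))
  exact (h x).hasDerivAt

/-- Symmetry of mixed partial derivatives. -/
lemma pdt_pdx_comm (hf : ContDiff ℝ (⊤ : ℕ∞) (fun p : ℝ × ℝ => f p.1 p.2)) (x t : ℝ) :
    pdt (pdx f) x t = pdx (pdt f) x t := by
  have hd : Differentiable ℝ (fun p : ℝ × ℝ => f p.1 p.2) := hf.differentiable (by simp)
  have hd2 : Differentiable ℝ (fderiv ℝ (fun p : ℝ × ℝ => f p.1 p.2)) :=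
    (hf.fderiv_right (m := (⊤ : ℕ∞)) (by simp)).differentiable (by simp)
  rw [pdt_eq_fderiv ((contDiff_pdx hf).differentiable (by simp)),
    pdx_eq_fderiv ((contDiff_pdt hf).differentiable (by simp))]
  simp_rw [pdx_eq_fderiv hd, pdt_eq_fderiv hd]
  rw [fderiv_clm_apply (hd2 _) (differentiableAt_const _),
    fderiv_clm_apply (hd2 _) (differentiableAt_const _)]
  simpa using (((contDiff_infty.1 hf 2).contDiffAt (x := (x, t))).isSymmSndFDerivAt
    (by simp)).eq (0, 1) (1, 0)

/-- Chain rule in the second variable along a curve `s ↦ (g s, s)`. -/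
lemma hasDerivAt_comp_graph (hf : Differentiable ℝ (fun p : ℝ × ℝ => f p.1 p.2))
    {g : ℝ → ℝ} {g' t : ℝ} (hg : HasDerivAt g g' t) :
    HasDerivAt (fun s => f (g s) s) (g' * pdx f (g t) t + pdt f (g t) t) t := by
  have h := (hf (g t, t)).hasFDerivAt.comp_hasDerivAt (f := fun s => (g s, s)) t
    (hg.prodMk (hasDerivAt_id t))
  have e : ((g', 1) : ℝ × ℝ) = g' • (1, 0) + (0, 1) := by simp
  rw [e, map_add, map_smul, ← pdx_eq_fderiv hf, ← pdt_eq_fderiv hf] at h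
  exact h

end PartialDerivatives

lemma contDiff_Ffun {n : ℕ} (c : Fin n → Fin n → ℝ) {u : Fin n → ℝ → ℝ → ℝ}
    (hu : ∀ i, ContDiff ℝ (⊤ : ℕ∞) (fun p : ℝ × ℝ => u i p.1 p.2)) :
    ContDiff ℝ (⊤ : ℕ∞) (fun p : ℝ × ℝ => Ffun c u p.1 p.2) := by
  unfold Ffun
  refine ContDiff.sum fun j _ => ContDiff.sum fun k _ => ?_
  split_ifs
  · exact (contDiff_const.mul (hu j)).mul (hu k)
  · exact contDiff_const

/-- the hodograph transformation maps smooth solutions of the MCSP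
    equation to solutions of the multi-component coupled integrable dispersionless
    equations. -/
theorem mcsp_hodograph_to_dispersionless (n : ℕ) (hn : 1 ≤ n)
    (c : Fin n → Fin n → ℝ) (u : Fin n → ℝ → ℝ → ℝ)
    (hu : ∀ i, ContDiff ℝ (⊤ : ℕ∞) (fun p : ℝ × ℝ => u i p.1 p.2))
    (hmcsp : ∀ i x t,
      pdx (pdt (u i)) x t
        = u i x t
          + (1/2) * pdx (fun x' t' => Ffun c u x' t' * pdx (u i) x' t') x t)
    (hSpos : ∀ x t, 0 < 1 + Sfun c u x t)
    (φ : ℝ → ℝ → ℝ)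
    (hφ : ContDiff ℝ (⊤ : ℕ∞) (fun p : ℝ × ℝ => φ p.1 p.2))
    (hφX : ∀ X T, pdx φ X T = (Real.sqrt (1 + Sfun c u (φ X T) T))⁻¹)
    (hφT : ∀ X T, pdt φ X T = - Ffun c u (φ X T) T / 2)
    (U : Fin n → ℝ → ℝ → ℝ)
    (hU : ∀ i X T, U i X T = u i (φ X T) T)
    (R : ℝ → ℝ → ℝ)
    (hR : ∀ X T, R X T = (Real.sqrt (1 + Sfun c u (φ X T) T))⁻¹) :
    (∀ i X T, pdx (pdt (U i)) X T = U i X T * R X T) ∧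
    (∀ X T,
      pdt R X T
        + (1/2) * pdx (fun X' T' => ∑ j : Fin n, ∑ k : Fin n,
            if j < k then c j k * U j X' T' * U k X' T' else 0) X T = 0) := by
  have hφd : Differentiable ℝ (fun p : ℝ × ℝ => φ p.1 p.2) := hφ.differentiable (by simp)
  have hRφ : R = pdx φ := by
    funext X T
    rw [hR, hφX]
  constructor
  · intro i X T
    have hUT : pdt (U i) = fun X T =>
        pdt (u i) (φ X T) T - 1 / 2 * (Ffun c u (φ X T) T * pdx (u i) (φ X T) T) := by
      funext X T
      have hg : HasDerivAt (fun s => φ X s) (pdt φ X T) T := by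
        have h : Differentiable ℝ (fun s => φ X s) :=
          hφd.comp ((differentiable_const X).prodMk differentiable_id)
        exact (h T).hasDerivAt
      have h := (hasDerivAt_comp_graph ((hu i).differentiable (by simp)) hg).deriv
      simp_rw [pdt, hU]
      rw [h, hφT, pdt]
      ring
    have hflux : Differentiable ℝ (fun p : ℝ × ℝ => Ffun c u p.1 p.2 * pdx (u i) p.1 p.2) :=
      ((contDiff_Ffun c hu).mul (contDiff_pdx (hu i))).differentiable (by simp)
    have hx := (hasDerivAt_pdx ((contDiff_pdt (hu i)).differentiable (by simp)) (φ X T) T).sub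
      ((hasDerivAt_pdx (f := fun x t => Ffun c u x t * pdx (u i) x t) hflux
        (φ X T) T).const_mul (1 / 2))
    have hX := (hx.comp X (hasDerivAt_pdx hφd X T)).deriv
    rw [hUT, hU, hRφ]
    refine hX.trans ?_
    rw [hmcsp]
    ring
  · intro X T
    have hsum : (fun X' T' => ∑ j : Fin n, ∑ k : Fin n,
        if j < k then c j k * U j X' T' * U k X' T' else 0) = fun X T => -2 * pdt φ X T := by
      funext X T
      rw [hφT, Ffun]
      simp_rw [hU]
      ring
    have h := ((hasDerivAt_pdx ((contDiff_pdt hφ).differentiable (by simp)) X T).const_mul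
      (-2)).deriv
    rw [hsum, hRφ, pdt_pdx_comm hφ]
    change _ + 1 / 2 * deriv (fun y => -2 * pdt φ y T) X = 0
    rw [h]
    ring
end

section
/- Let p_1, p_2, p_3, p_4 be nonzero reals with p_j + p_k ≠ 0 for all j ∈ {1,2}, k ∈ {3,4}, and let a_1,…,a_4, ξ_1,…,ξ_4 ∈ ℝ. Set b_{jk} = (p_j p_k/(p_j+p_k))² and η_j(X,T) = p_j X + T/p_j + ξ_j. Define f := 1 + (a_1a_3 b_{13}/4) e^{η_1+η_3} + (a_2a_3 b_{23}/4) e^{η_2+η_3} + (a_1a_4 b_{14}/4) e^{η_1+η_4} + (a_2a_4 b_{24}/4) e^{η_2+η_4} + a_1a_2a_3a_4 (p_1−p_2)²(p_3−p_4)² · b_{13}b_{23}b_{14}b_{24}/(16 p_1²p_2²p_3²p_4²) · e^{η_1+η_2+η_3+η_4}, g^{(1)} := a_1 e^{η_1} + a_2 e^{η_2} + a_1a_2a_3 (p_1−p_2)² p_3⁴/(4(p_1+p_3)²(p_2+p_3)²) e^{η_1+η_2+η_3} + a_1a_2a_4 (p_1−p_2)² p_4⁴/(4(p_1+p_4)²(p_2+p_4)²)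 e^{η_1+η_2+η_4}, g^{(2)} := a_3 e^{η_3} + a_4 e^{η_4} + a_2a_3a_4 (p_3−p_4)² p_2⁴/(4(p_2+p_3)²(p_2+p_4)²) e^{η_2+η_3+η_4} + a_1a_3a_4 (p_3−p_4)² p_1⁴/(4(p_1+p_3)²(p_1+p_4)²) e^{η_1+η_3+η_4}. Then f_{XT} g^{(i)} − f_X g^{(i)}_T − f_T g^{(i)}_X + f g^{(i)}_{XT} = f·g^{(i)} for i = 1,2, and f_{TT} f − (f_T)² = (1/4) g^{(1)} g^{(2)}. -/
/-- The sum of exponentials `∑ cᵢ exp (kᵢ X + wᵢ T + dᵢ)`. -/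
noncomputable def expSum {n : ℕ} (c k w d : Fin n → ℝ) (X T : ℝ) : ℝ :=
  ∑ i, c i * Real.exp (k i * X + w i * T + d i)

theorem pdx_expSum {n : ℕ} (c k w d : Fin n → ℝ) :
    pdx (expSum c k w d) = expSum (fun i => c i * k i) k w d := by
  funext X T
  have h (i : Fin n) : HasDerivAt (fun y => k i * y + w i * T + d i) (k i) X := by
    simpa using (((hasDerivAt_id X).const_mul (k i)).add_const (w i * T)).add_const (d i)
  refine (HasDerivAt.fun_sum fun i _ => (h i).exp.const_mul (c i)).deriv.trans ?_
  exact Finset.sum_congr rfl fun i _ => by ring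

theorem pdt_expSum {n : ℕ} (c k w d : Fin n → ℝ) :
    pdt (expSum c k w d) = expSum (fun i => c i * w i) k w d := by
  funext X T
  have h (i : Fin n) : HasDerivAt (fun s => k i * X + w i * s + d i) (w i) T := by
    simpa using (((hasDerivAt_id T).const_mul (w i)).const_add (k i * X)).add_const (d i)
  refine (HasDerivAt.fun_sum fun i _ => (h i).exp.const_mul (c i)).deriv.trans ?_
  exact Finset.sum_congr rfl fun i _ => by ring

/-- The mixed bilinear equation for a pair of exponential sums, given the vanishing of the
coefficients of the monomials to which several pairs of terms contribute. -/
theorem mixed_bilinear_of_coeff {p₁ p₂ p₃ p₄ q₁ q₂ q₃ q₄ ξ₁ ξ₂ ξ₃ ξ₄ : ℝ}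
    {η₁ η₂ η₃ η₄ : ℝ → ℝ → ℝ}
    (hη₁ : ∀ X T, η₁ X T = p₁ * X + q₁ * T + ξ₁)
    (hη₂ : ∀ X T, η₂ X T = p₂ * X + q₂ * T + ξ₂)
    (hη₃ : ∀ X T, η₃ X T = p₃ * X + q₃ * T + ξ₃)
    (hη₄ : ∀ X T, η₄ X T = p₄ * X + q₄ * T + ξ₄)
    (h₁ : p₁ * q₁ = 1)
    (h₂ : p₂ * q₂ = 1)
    (h₃ : p₃ * q₃ = 1)
    (h₄ : p₄ * q₄ = 1)
    {F₁₃ F₂₃ F₁₄ F₂₄ F₁₂₃₄ G₁ G₂ G₁₂₃ G₁₂₄ : ℝ}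
    {f g : ℝ → ℝ → ℝ}
    (hf : ∀ X T, f X T = 1
      + F₁₃ * Real.exp (η₁ X T + η₃ X T)
      + F₂₃ * Real.exp (η₂ X T + η₃ X T)
      + F₁₄ * Real.exp (η₁ X T + η₄ X T)
      + F₂₄ * Real.exp (η₂ X T + η₄ X T)
      + F₁₂₃₄ * Real.exp (η₁ X T + η₂ X T + η₃ X T + η₄ X T))
    (hg : ∀ X T, g X T = G₁ * Real.exp (η₁ X T)
      + G₂ * Real.exp (η₂ X T)
      + G₁₂₃ * Real.exp (η₁ X T + η₂ X T + η₃ X T)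
      + G₁₂₄ * Real.exp (η₁ X T + η₂ X T + η₄ X T))
    (c₁₂₃ : G₁₂₃ * ((p₁ + p₂ + p₃) * (q₁ + q₂ + q₃) - 1)
      + F₁₃ * G₂ * ((-p₁ + p₂ - p₃) * (-q₁ + q₂ - q₃) - 1)
      + F₂₃ * G₁ * ((p₁ - p₂ - p₃) * (q₁ - q₂ - q₃) - 1)
        = 0)
    (c₁₂₄ : G₁₂₄ * ((p₁ + p₂ + p₄) * (q₁ + q₂ + q₄) - 1)
      + F₁₄ * G₂ * ((-p₁ + p₂ - p₄) * (-q₁ + q₂ - q₄) - 1)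
      + F₂₄ * G₁ * ((p₁ - p₂ - p₄) * (q₁ - q₂ - q₄) - 1)
        = 0)
    (c₁₁₂₃₄ : F₁₃ * G₁₂₄ * ((p₂ - p₃ + p₄) * (q₂ - q₃ + q₄) - 1)
      + F₁₄ * G₁₂₃ * ((p₂ + p₃ - p₄) * (q₂ + q₃ - q₄) - 1)
      + F₁₂₃₄ * G₁ * ((-p₂ - p₃ - p₄) * (-q₂ - q₃ - q₄) - 1)
        = 0)
    (c₁₂₂₃₄ : F₂₃ * G₁₂₄ * ((p₁ - p₃ + p₄) * (q₁ - q₃ + q₄) - 1)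
      + F₂₄ * G₁₂₃ * ((p₁ + p₃ - p₄) * (q₁ + q₃ - q₄) - 1)
      + F₁₂₃₄ * G₂ * ((-p₁ - p₃ - p₄) * (-q₁ - q₃ - q₄) - 1)
        = 0)
    (X T : ℝ) :
    pdx (pdt f) X T * g X T - pdx f X T * pdt g X T
        - pdt f X T * pdx g X T + f X T * pdx (pdt g) X T = f X T * g X T := by
  have ef : f = expSum ![1, F₁₃, F₂₃, F₁₄, F₂₄, F₁₂₃₄]
      ![0, p₁ + p₃, p₂ + p₃, p₁ + p₄, p₂ + p₄, p₁ + p₂ + p₃ + p₄]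
      ![0, q₁ + q₃, q₂ + q₃, q₁ + q₄, q₂ + q₄, q₁ + q₂ + q₃ + q₄]
      ![0, ξ₁ + ξ₃, ξ₂ + ξ₃, ξ₁ + ξ₄, ξ₂ + ξ₄, ξ₁ + ξ₂ + ξ₃ + ξ₄] := by
    funext X T
    simp [hf, hη₁, hη₂, hη₃, hη₄, expSum, Fin.sum_univ_succ, Real.exp_add, add_mul]
    ring
  have eg : g = expSum ![G₁, G₂, G₁₂₃, G₁₂₄]
      ![p₁, p₂, p₁ + p₂ + p₃, p₁ + p₂ + p₄]
      ![q₁, q₂, q₁ + q₂ + q₃, q₁ + q₂ + q₄]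
      ![ξ₁, ξ₂, ξ₁ + ξ₂ + ξ₃, ξ₁ + ξ₂ + ξ₄] := by
    funext X T
    simp [hg, hη₁, hη₂, hη₃, hη₄, expSum, Fin.sum_univ_succ, Real.exp_add, add_mul]
    ring
  rw [ef, eg]
  simp only [pdt_expSum, pdx_expSum]
  simp [expSum, Fin.sum_univ_succ, Real.exp_add, add_mul, -mul_eq_mul_left_iff,
    -mul_eq_mul_right_iff]
  let E₁ := Real.exp (p₁ * X) * Real.exp (q₁ * T) * Real.exp ξ₁
  let E₂ := Real.exp (p₂ * X) * Real.exp (q₂ * T) * Real.exp ξ₂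
  let E₃ := Real.exp (p₃ * X) * Real.exp (q₃ * T) * Real.exp ξ₃
  let E₄ := Real.exp (p₄ * X) * Real.exp (q₄ * T) * Real.exp ξ₄
  linear_combination
    G₁ * E₁ * h₁ +
    G₂ * E₂ * h₂ +
    E₁ * E₂ * E₃ * c₁₂₃ +
    E₁ * E₂ * E₄ * c₁₂₄ +
    F₁₃ * G₁ * E₁^2 * E₃ * h₃ +
    F₁₃ * G₁₂₃ * E₁^2 * E₂ * E₃^2 * h₂ +
    E₁^2 * E₂ * E₃ * E₄ * c₁₁₂₃₄ +
    F₂₃ * G₂ * E₂^2 * E₃ * h₃ +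
    F₂₃ * G₁₂₃ * E₁ * E₂^2 * E₃^2 * h₁ +
    E₁ * E₂^2 * E₃ * E₄ * c₁₂₂₃₄ +
    F₁₄ * G₁ * E₁^2 * E₄ * h₄ +
    F₁₄ * G₁₂₄ * E₁^2 * E₂ * E₄^2 * h₂ +
    F₂₄ * G₂ * E₂^2 * E₄ * h₄ +
    F₂₄ * G₁₂₄ * E₁ * E₂^2 * E₄^2 * h₁ +
    F₁₂₃₄ * G₁₂₃ * E₁^2 * E₂^2 * E₃^2 * E₄ * h₄ +
    F₁₂₃₄ * G₁₂₄ * E₁^2 * E₂^2 * E₃ * E₄^2 * h₃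

/-- The `T`-bilinear equation for a triple of exponential sums, given the equality of the
coefficients of all monomials. -/
theorem temporal_bilinear_of_coeff {p₁ p₂ p₃ p₄ q₁ q₂ q₃ q₄ ξ₁ ξ₂ ξ₃ ξ₄ : ℝ}
    {η₁ η₂ η₃ η₄ : ℝ → ℝ → ℝ}
    (hη₁ : ∀ X T, η₁ X T = p₁ * X + q₁ * T + ξ₁)
    (hη₂ : ∀ X T, η₂ X T = p₂ * X + q₂ * T + ξ₂)
    (hη₃ : ∀ X T, η₃ X T = p₃ * X + q₃ * T + ξ₃)
    (hη₄ : ∀ X T, η₄ X T = p₄ * X + q₄ * T + ξ₄)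
    {F₁₃ F₂₃ F₁₄ F₂₄ F₁₂₃₄ G₁ G₂ G₁₂₃ G₁₂₄ K₃ K₄ K₂₃₄ K₁₃₄ : ℝ}
    {f g k : ℝ → ℝ → ℝ}
    (hf : ∀ X T, f X T = 1
      + F₁₃ * Real.exp (η₁ X T + η₃ X T)
      + F₂₃ * Real.exp (η₂ X T + η₃ X T)
      + F₁₄ * Real.exp (η₁ X T + η₄ X T)
      + F₂₄ * Real.exp (η₂ X T + η₄ X T)
      + F₁₂₃₄ * Real.exp (η₁ X T + η₂ X T + η₃ X T + η₄ X T))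
    (hg : ∀ X T, g X T = G₁ * Real.exp (η₁ X T)
      + G₂ * Real.exp (η₂ X T)
      + G₁₂₃ * Real.exp (η₁ X T + η₂ X T + η₃ X T)
      + G₁₂₄ * Real.exp (η₁ X T + η₂ X T + η₄ X T))
    (hk : ∀ X T, k X T = K₃ * Real.exp (η₃ X T)
      + K₄ * Real.exp (η₄ X T)
      + K₂₃₄ * Real.exp (η₂ X T + η₃ X T + η₄ X T)
      + K₁₃₄ * Real.exp (η₁ X T + η₃ X T + η₄ X T))
    (c₁₃ : F₁₃ * (q₁ + q₃)^2 = 1 / 4 * (G₁ * K₃))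
    (c₂₃ : F₂₃ * (q₂ + q₃)^2 = 1 / 4 * (G₂ * K₃))
    (c₁₂₃₃ : F₁₃ * F₂₃ * (-q₁ + q₂)^2 = 1 / 4 * (G₁₂₃ * K₃))
    (c₁₄ : F₁₄ * (q₁ + q₄)^2 = 1 / 4 * (G₁ * K₄))
    (c₁₁₃₄ : F₁₃ * F₁₄ * (-q₃ + q₄)^2 = 1 / 4 * (G₁ * K₁₃₄))
    (c₁₂₃₄ : F₂₃ * F₁₄ * (q₁ - q₂ - q₃ + q₄)^2
      + F₁₃ * F₂₄ * (-q₁ + q₂ - q₃ + q₄)^2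
      + F₁₂₃₄ * (q₁ + q₂ + q₃ + q₄)^2
        = 1 / 4 * (G₁ * K₂₃₄ + G₂ * K₁₃₄ + G₁₂₃ * K₄ + G₁₂₄ * K₃))
    (c₂₄ : F₂₄ * (q₂ + q₄)^2 = 1 / 4 * (G₂ * K₄))
    (c₂₂₃₄ : F₂₃ * F₂₄ * (-q₃ + q₄)^2 = 1 / 4 * (G₂ * K₂₃₄))
    (c₁₂₄₄ : F₁₄ * F₂₄ * (-q₁ + q₂)^2 = 1 / 4 * (G₁₂₄ * K₄))
    (c₁₁₂₃₃₄ : F₁₃ * F₁₂₃₄ * (q₂ + q₄)^2 = 1 / 4 * (G₁₂₃ * K₁₃₄))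
    (c₁₂₂₃₃₄ : F₂₃ * F₁₂₃₄ * (q₁ + q₄)^2 = 1 / 4 * (G₁₂₃ * K₂₃₄))
    (c₁₁₂₃₄₄ : F₁₄ * F₁₂₃₄ * (q₂ + q₃)^2 = 1 / 4 * (G₁₂₄ * K₁₃₄))
    (c₁₂₂₃₄₄ : F₂₄ * F₁₂₃₄ * (q₁ + q₃)^2 = 1 / 4 * (G₁₂₄ * K₂₃₄)) (X T : ℝ) :
    pdt (pdt f) X T * f X T - (pdt f X T)^2 = (1/4) * (g X T * k X T) := by
  have ef : f = expSum ![1, F₁₃, F₂₃, F₁₄, F₂₄, F₁₂₃₄]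
      ![0, p₁ + p₃, p₂ + p₃, p₁ + p₄, p₂ + p₄, p₁ + p₂ + p₃ + p₄]
      ![0, q₁ + q₃, q₂ + q₃, q₁ + q₄, q₂ + q₄, q₁ + q₂ + q₃ + q₄]
      ![0, ξ₁ + ξ₃, ξ₂ + ξ₃, ξ₁ + ξ₄, ξ₂ + ξ₄, ξ₁ + ξ₂ + ξ₃ + ξ₄] := by
    funext X T
    simp [hf, hη₁, hη₂, hη₃, hη₄, expSum, Fin.sum_univ_succ, Real.exp_add, add_mul]
    ring
  rw [ef]
  simp only [pdt_expSum, hg, hk, hη₁, hη₂, hη₃, hη₄]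
  simp [expSum, Fin.sum_univ_succ, Real.exp_add, add_mul]
  let E₁ := Real.exp (p₁ * X) * Real.exp (q₁ * T) * Real.exp ξ₁
  let E₂ := Real.exp (p₂ * X) * Real.exp (q₂ * T) * Real.exp ξ₂
  let E₃ := Real.exp (p₃ * X) * Real.exp (q₃ * T) * Real.exp ξ₃
  let E₄ := Real.exp (p₄ * X) * Real.exp (q₄ * T) * Real.exp ξ₄
  linear_combination
    E₁ * E₃ * c₁₃ +
    E₂ * E₃ * c₂₃ +
    E₁ * E₂ * E₃^2 * c₁₂₃₃ +
    E₁ * E₄ * c₁₄ +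
    E₁^2 * E₃ * E₄ * c₁₁₃₄ +
    E₁ * E₂ * E₃ * E₄ * c₁₂₃₄ +
    E₂ * E₄ * c₂₄ +
    E₂^2 * E₃ * E₄ * c₂₂₃₄ +
    E₁ * E₂ * E₄^2 * c₁₂₄₄ +
    E₁^2 * E₂ * E₃^2 * E₄ * c₁₁₂₃₃₄ +
    E₁ * E₂^2 * E₃^2 * E₄ * c₁₂₂₃₃₄ +
    E₁^2 * E₂ * E₃ * E₄^2 * c₁₁₂₃₄₄ +
    E₁ * E₂^2 * E₃ * E₄^2 * c₁₂₂₃₄₄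

/-- the two-soliton tau functions satisfy the bilinear form of the
    2-component short pulse equation. -/
theorem twoComponent_SP_two_soliton (p₁ p₂ p₃ p₄ : ℝ)
    (hp₁ : p₁ ≠ 0) (hp₂ : p₂ ≠ 0) (hp₃ : p₃ ≠ 0) (hp₄ : p₄ ≠ 0)
    (hp₁₃ : p₁ + p₃ ≠ 0) (hp₁₄ : p₁ + p₄ ≠ 0)
    (hp₂₃ : p₂ + p₃ ≠ 0) (hp₂₄ : p₂ + p₄ ≠ 0)
    (a₁ a₂ a₃ a₄ ξ₁ ξ₂ ξ₃ ξ₄ : ℝ)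
    (b₁₃ b₂₃ b₁₄ b₂₄ : ℝ)
    (hb₁₃ : b₁₃ = (p₁ * p₃ / (p₁ + p₃))^2)
    (hb₂₃ : b₂₃ = (p₂ * p₃ / (p₂ + p₃))^2)
    (hb₁₄ : b₁₄ = (p₁ * p₄ / (p₁ + p₄))^2)
    (hb₂₄ : b₂₄ = (p₂ * p₄ / (p₂ + p₄))^2)
    (η₁ η₂ η₃ η₄ : ℝ → ℝ → ℝ)
    (hη₁ : ∀ X T, η₁ X T = p₁ * X + T / p₁ + ξ₁)
    (hη₂ : ∀ X T, η₂ X T = p₂ * X + T / p₂ + ξ₂)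
    (hη₃ : ∀ X T, η₃ X T = p₃ * X + T / p₃ + ξ₃)
    (hη₄ : ∀ X T, η₄ X T = p₄ * X + T / p₄ + ξ₄)
    (f g₁ g₂ : ℝ → ℝ → ℝ)
    (hf : ∀ X T, f X T =
      1 + a₁ * a₃ * b₁₃ / 4 * Real.exp (η₁ X T + η₃ X T)
        + a₂ * a₃ * b₂₃ / 4 * Real.exp (η₂ X T + η₃ X T)
        + a₁ * a₄ * b₁₄ / 4 * Real.exp (η₁ X T + η₄ X T)
        + a₂ * a₄ * b₂₄ / 4 * Real.exp (η₂ X T + η₄ X T)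
        + a₁ * a₂ * a₃ * a₄ * (p₁ - p₂)^2 * (p₃ - p₄)^2
            * (b₁₃ * b₂₃ * b₁₄ * b₂₄ / (16 * p₁^2 * p₂^2 * p₃^2 * p₄^2))
            * Real.exp (η₁ X T + η₂ X T + η₃ X T + η₄ X T))
    (hg₁ : ∀ X T, g₁ X T =
      a₁ * Real.exp (η₁ X T) + a₂ * Real.exp (η₂ X T)
        + a₁ * a₂ * a₃ * (p₁ - p₂)^2 * p₃^4 / (4 * (p₁ + p₃)^2 * (p₂ + p₃)^2)
            * Real.exp (η₁ X T + η₂ X T + η₃ X T)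
        + a₁ * a₂ * a₄ * (p₁ - p₂)^2 * p₄^4 / (4 * (p₁ + p₄)^2 * (p₂ + p₄)^2)
            * Real.exp (η₁ X T + η₂ X T + η₄ X T))
    (hg₂ : ∀ X T, g₂ X T =
      a₃ * Real.exp (η₃ X T) + a₄ * Real.exp (η₄ X T)
        + a₂ * a₃ * a₄ * (p₃ - p₄)^2 * p₂^4 / (4 * (p₂ + p₃)^2 * (p₂ + p₄)^2)
            * Real.exp (η₂ X T + η₃ X T + η₄ X T)
        + a₁ * a₃ * a₄ * (p₃ - p₄)^2 * p₁^4 / (4 * (p₁ + p₃)^2 * (p₁ + p₄)^2)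
            * Real.exp (η₁ X T + η₃ X T + η₄ X T)) :
    (∀ X T,
      pdx (pdt f) X T * g₁ X T - pdx f X T * pdt g₁ X T
        - pdt f X T * pdx g₁ X T + f X T * pdx (pdt g₁) X T
        = f X T * g₁ X T) ∧
    (∀ X T,
      pdx (pdt f) X T * g₂ X T - pdx f X T * pdt g₂ X T
        - pdt f X T * pdx g₂ X T + f X T * pdx (pdt g₂) X T
        = f X T * g₂ X T) ∧
    (∀ X T,
      pdt (pdt f) X T * f X T - (pdt f X T)^2 = (1/4) * (g₁ X T * g₂ X T)) := by
  have hφ₁ : ∀ X T, η₁ X T = p₁ * X + (p₁)⁻¹ * T + ξ₁ := fun X T => by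
    rw [hη₁, div_eq_inv_mul]
  have hφ₂ : ∀ X T, η₂ X T = p₂ * X + (p₂)⁻¹ * T + ξ₂ := fun X T => by
    rw [hη₂, div_eq_inv_mul]
  have hφ₃ : ∀ X T, η₃ X T = p₃ * X + (p₃)⁻¹ * T + ξ₃ := fun X T => by
    rw [hη₃, div_eq_inv_mul]
  have hφ₄ : ∀ X T, η₄ X T = p₄ * X + (p₄)⁻¹ * T + ξ₄ := fun X T => by
    rw [hη₄, div_eq_inv_mul]
  refine ⟨?_, ?_, ?_⟩
  · apply mixed_bilinear_of_coeff hφ₁ hφ₂ hφ₃ hφ₄ (mul_inv_cancel₀ hp₁) (mul_inv_cancel₀ hp₂)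
      (mul_inv_cancel₀ hp₃) (mul_inv_cancel₀ hp₄) hf hg₁
    all_goals
      simp only [hb₁₃, hb₂₃, hb₁₄, hb₂₄]
      field_simp
      ring
  · apply mixed_bilinear_of_coeff hφ₃ hφ₄ hφ₁ hφ₂ (mul_inv_cancel₀ hp₃) (mul_inv_cancel₀ hp₄)
      (mul_inv_cancel₀ hp₁) (mul_inv_cancel₀ hp₂)
      (F₁₃ := a₁ * a₃ * b₁₃ / 4) (F₂₃ := a₁ * a₄ * b₁₄ / 4)
      (F₁₄ := a₂ * a₃ * b₂₃ / 4) (F₂₄ := a₂ * a₄ * b₂₄ / 4)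
      (F₁₂₃₄ := a₁ * a₂ * a₃ * a₄ * (p₁ - p₂)^2 * (p₃ - p₄)^2
            * (b₁₃ * b₂₃ * b₁₄ * b₂₄ / (16 * p₁^2 * p₂^2 * p₃^2 * p₄^2)))
      (G₁ := a₃) (G₂ := a₄)
      (G₁₂₃ := a₁ * a₃ * a₄ * (p₃ - p₄)^2 * p₁^4 / (4 * (p₁ + p₃)^2 * (p₁ + p₄)^2))
      (G₁₂₄ := a₂ * a₃ * a₄ * (p₃ - p₄)^2 * p₂^4 / (4 * (p₂ + p₃)^2 * (p₂ + p₄)^2))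
    · intro X T
      simp only [hf, Real.exp_add]
      ring
    · intro X T
      simp only [hg₂, Real.exp_add]
      ring
    all_goals
      simp only [hb₁₃, hb₂₃, hb₁₄, hb₂₄]
      field_simp
      ring
  · apply temporal_bilinear_of_coeff hφ₁ hφ₂ hφ₃ hφ₄ hf hg₁ hg₂
    all_goals
      simp only [hb₁₃, hb₂₃, hb₁₄, hb₂₄]
      field_simp
      ring
end
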